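/- Let (X, μ) be a standard Borel probability space, f : X → X a measurable bijection with measurable inverse preserving μ, and ξ a finite measurable partition of X given by a labeling map ℓ : X → Fin k. Suppose that for every ε > 0 there exists N ∈ ℕ such that for all m₂ ≥ m₁ ≥ N, for ε-almost every atom E of ⋁_{j=m₁}^{m₂} f^j ξ there exist a map θ : E → X that is ε-measure-preserving from (E, μ|_E) to (X, μ), and a measurable set D ⊆ E with μ|_E(D) > 1 − ε such that h_n(x, θ(x)) < ε for every n ≥ 1 and every x ∈ D. Then ξ is Very Weak Bernoulli: for every ε > 0 there exists N₀ ∈ ℕ such that for all m₂ ≥ m₁ ≥ N₀ and every n ≥ 1, for ε-almost every atom E of ⋁_{j=m₁}^{m₂} f^j ξ, the infimum over all couplings λ of (E, μ|_E) and (X, μ) of ∫ h_n dλ is at most ε. -/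

import Mathlib

open MeasureTheory

namespace VWB14

variable {X : Type*} [MeasurableSpace X]

/-- The normalized restriction `μ|_E(S) = μ(S ∩ E)/μ(E)`. -/
noncomputable def normRestrict (μ : Measure X) (E : Set X) : Measure X :=
  (μ E)⁻¹ • μ.restrict E

/-- The atom of the join `⋁_{j=m₁}^{m₂} f^j ξ` determined by the labels `a`, where `g` is
the inverse of `f` and `ℓ` is the labeling map of the finite partition `ξ`. -/
def joinAtom {k : ℕ} (ℓ : X → Fin k) (g : X → X) (m₁ m₂ : ℕ) (a : ℕ → Fin k) : Set X :=
  {x | ∀ j : ℕ, m₁ ≤ j → j ≤ m₂ → ℓ (g^[j] x) = a j}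

/-- A property `P` holds for `ε`-almost every atom of the join `⋁_{j=m₁}^{m₂} f^j ξ`: the
union of the (nonempty) atoms failing `P` has `μ`-measure at most `ε`. -/
def AeAtoms {k : ℕ} (μ : Measure X) (ℓ : X → Fin k) (g : X → X) (m₁ m₂ : ℕ) (ε : ℝ)
    (P : Set X → Prop) : Prop :=
  (μ (⋃ a ∈ {a : ℕ → Fin k | (joinAtom ℓ g m₁ m₂ a).Nonempty ∧
      ¬P (joinAtom ℓ g m₁ m₂ a)}, joinAtom ℓ g m₁ m₂ a)).toReal ≤ ε

/-- `h_n(x,y) = (1/n)·#{1 ≤ i ≤ n : ℓ(fⁱx) ≠ ℓ(fⁱy)}`. -/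
noncomputable def hFreq {k : ℕ} (ℓ : X → Fin k) (f : X → X) (n : ℕ) (x y : X) : ℝ :=
  (n : ℝ)⁻¹ *
    (((Finset.Icc 1 n).filter fun i => ℓ (f^[i] x) ≠ ℓ (f^[i] y)).card : ℝ)

/-- `θ` is `ε`-measure-preserving from `(dom, μ)` to `ν`: there is a measurable
`G ⊆ dom` with `μ(G) > 1 − ε` such that `θ(A)` is measurable and
`(1−ε)·μ(A) ≤ ν(θ(A)) ≤ (1+ε)·μ(A)` for every measurable `A ⊆ G`. -/
def IsEpsMP (ε : ℝ) (μ ν : Measure X) (dom : Set X) (θ : X → X) : Prop :=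
  ∃ G : Set X, G ⊆ dom ∧ MeasurableSet G ∧ 1 - ε < (μ G).toReal ∧
    ∀ A : Set X, A ⊆ G → MeasurableSet A →
      MeasurableSet (θ '' A) ∧
      (1 - ε) * (μ A).toReal ≤ (ν (θ '' A)).toReal ∧
      (ν (θ '' A)).toReal ≤ (1 + ε) * (μ A).toReal

end VWB14

open VWB14

theorem VWB14.coupling_aux {X : Type*} [MeasurableSpace X] (P Q : Measure X)
    [IsProbabilityMeasure P] [IsProbabilityMeasure Q] (A B : ℕ → Set X)
    (hA : ∀ i, MeasurableSet (A i)) (hB : ∀ i, MeasurableSet (B i))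
    (dA : Pairwise (Function.onFun Disjoint A)) (dB : Pairwise (Function.onFun Disjoint B))
    (a : ENNReal) (ha1 : 1 ≤ a) (ha : a ≠ ⊤) (hAB : ∀ i, Q (B i) ≤ a * P (A i))
    (H : Set (X × X)) (hH : MeasurableSet H) (hd : ∀ i, Disjoint (A i ×ˢ B i) H) :
    ∃ lam : Measure (X × X), IsProbabilityMeasure lam ∧ lam.map Prod.fst = P ∧
      lam.map Prod.snd = Q ∧ lam H ≤ 1 - a⁻¹ * Q (⋃ i, B i) := by
  have ha0 : a ≠ 0 := (lt_of_lt_of_le one_pos ha1).ne'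
  set c : ℕ → ENNReal := fun i => (a * P (A i))⁻¹ with hc
  set L : Measure (X × X) :=
    Measure.sum fun i => c i • (P.restrict (A i)).prod (Q.restrict (B i)) with hL
  have hcQ : ∀ i, c i * Q (B i) ≤ 1 := fun i => by
    rw [hc, mul_comm, ← div_eq_mul_inv]
    exact ENNReal.div_le_of_le_mul (by simpa using hAB i)
  have hcP : ∀ i, c i * P (A i) ≤ 1 := fun i => by
    rw [hc, mul_comm, ← div_eq_mul_inv]
    refine ENNReal.div_le_of_le_mul ?_
    rw [one_mul]
    exact le_mul_of_one_le_left zero_le ha1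
  have hfst : L.map Prod.fst ≤ P := by
    refine Measure.le_iff.2 fun S hS => ?_
    rw [Measure.map_apply measurable_fst hS, hL, Measure.sum_apply _ (measurable_fst hS),
      ← Set.prod_univ]
    calc _ ≤ ∑' i, P (S ∩ A i) := by
          refine ENNReal.tsum_le_tsum fun i => ?_
          rw [Measure.smul_apply, Measure.prod_prod, smul_eq_mul, Measure.restrict_apply hS,
            Measure.restrict_apply_univ]
          calc _ = (c i * Q (B i)) * P (S ∩ A i) := by ring
            _ ≤ 1 * P (S ∩ A i) := by gcongr; exact hcQ i
            _ = _ := one_mul _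
      _ = P (⋃ i, S ∩ A i) := (measure_iUnion (fun i j hij =>
          (dA hij).mono Set.inter_subset_right Set.inter_subset_right)
          fun i => hS.inter (hA i)).symm
      _ ≤ P S := measure_mono (Set.iUnion_subset fun i => Set.inter_subset_left)
  have hsnd : L.map Prod.snd ≤ Q := by
    refine Measure.le_iff.2 fun S hS => ?_
    rw [Measure.map_apply measurable_snd hS, hL, Measure.sum_apply _ (measurable_snd hS),
      ← Set.univ_prod]
    calc _ ≤ ∑' i, Q (S ∩ B i) := by
          refine ENNReal.tsum_le_tsum fun i => ?_
          rw [Measure.smul_apply, Measure.prod_prod, smul_eq_mul, Measure.restrict_apply hS,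
            Measure.restrict_apply_univ]
          calc _ = (c i * P (A i)) * Q (S ∩ B i) := by ring
            _ ≤ 1 * Q (S ∩ B i) := by gcongr; exact hcP i
            _ = _ := one_mul _
      _ = Q (⋃ i, S ∩ B i) := (measure_iUnion (fun i j hij =>
          (dB hij).mono Set.inter_subset_right Set.inter_subset_right)
          fun i => hS.inter (hB i)).symm
      _ ≤ Q S := measure_mono (Set.iUnion_subset fun i => Set.inter_subset_left)
  have hmass : L Set.univ = a⁻¹ * Q (⋃ i, B i) := by
    rw [hL, Measure.sum_apply _ MeasurableSet.univ, measure_iUnion dB hB, ← ENNReal.tsum_mul_left]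
    refine tsum_congr fun i => ?_
    rw [Measure.smul_apply, ← Set.univ_prod_univ, Measure.prod_prod, smul_eq_mul,
      Measure.restrict_apply_univ, Measure.restrict_apply_univ]
    by_cases h0 : P (A i) = 0
    · have : Q (B i) = 0 := by simpa [h0] using hAB i
      simp [this]
    · rw [hc, ← mul_assoc]
      congr 1
      simp only
      rw [ENNReal.mul_inv (Or.inl ha0) (Or.inl ha), mul_assoc,
        ENNReal.inv_mul_cancel h0 (measure_ne_top _ _), mul_one]
  have hLH : L H = 0 := by
    rw [hL, Measure.sum_apply _ hH]
    simp only [ENNReal.tsum_eq_zero]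
    intro i
    rw [Measure.smul_apply, Measure.prod_restrict, Measure.restrict_apply hH,
      Set.inter_comm, (hd i).inter_eq]
    simp
  have hMle : L Set.univ ≤ 1 := by
    have := hfst Set.univ
    rwa [Measure.map_apply measurable_fst MeasurableSet.univ, Set.preimage_univ, measure_univ (μ := P)] at this
  have : IsFiniteMeasure L := ⟨lt_of_le_of_lt hMle ENNReal.one_lt_top⟩
  set M := L Set.univ with hM
  set R1 := P - L.map Prod.fst with hR1
  set R2 := Q - L.map Prod.snd with hR2
  have m1 : R1 Set.univ = 1 - M := by
    rw [hR1, Measure.sub_apply MeasurableSet.univ hfst,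
      Measure.map_apply measurable_fst MeasurableSet.univ, Set.preimage_univ, measure_univ]
  have m2 : R2 Set.univ = 1 - M := by
    rw [hR2, Measure.sub_apply MeasurableSet.univ hsnd,
      Measure.map_apply measurable_snd MeasurableSet.univ, Set.preimage_univ, measure_univ]
  have key : ∀ R : Measure X, R Set.univ = 1 - M → ((1 - M)⁻¹ * (1 - M)) • R = R := by
    intro R hR
    by_cases h : 1 - M = 0
    · rw [h, Measure.measure_univ_eq_zero] at hR
      simp [hR]
    · rw [ENNReal.inv_mul_cancel h (ne_top_of_le_ne_top ENNReal.one_ne_top tsub_le_self), one_smul]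
  have e1 : (L + (1 - M)⁻¹ • R1.prod R2).map Prod.fst = P := by
    rw [Measure.map_add _ _ measurable_fst, Measure.map_smul, Measure.map_fst_prod, m2, smul_smul,
      key _ m1, hR1, add_comm]
    exact Measure.sub_add_cancel_of_le hfst
  have e2 : (L + (1 - M)⁻¹ • R1.prod R2).map Prod.snd = Q := by
    rw [Measure.map_add _ _ measurable_snd, Measure.map_smul, Measure.map_snd_prod, m1, smul_smul,
      key _ m2, hR2, add_comm]
    exact Measure.sub_add_cancel_of_le hsnd
  refine ⟨L + (1 - M)⁻¹ • R1.prod R2, ⟨?_⟩, e1, e2, ?_⟩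
  · rw [← Set.preimage_univ (f := Prod.fst), ← Measure.map_apply measurable_fst MeasurableSet.univ,
      e1, measure_univ]
  · rw [Measure.add_apply, hLH, zero_add, ← hmass, Measure.smul_apply, smul_eq_mul]
    calc (1 - M)⁻¹ * (R1.prod R2) H ≤ (1 - M)⁻¹ * (R1.prod R2) Set.univ := by
          gcongr; exact Set.subset_univ _
      _ = ((1 - M)⁻¹ * (1 - M)) * (1 - M) := by
          rw [← Set.univ_prod_univ, Measure.prod_prod, m1, m2, mul_assoc]
      _ ≤ 1 * (1 - M) := by gcongr; exact ENNReal.inv_mul_le_one _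
      _ = _ := one_mul _

theorem VWB14.hFreq_nonneg {X : Type*} {k : ℕ} (ℓ : X → Fin k) (f : X → X) (n : ℕ) (x y : X) :
    0 ≤ hFreq ℓ f n x y := by
  unfold hFreq; positivity

theorem VWB14.hFreq_le_one {X : Type*} {k : ℕ} (ℓ : X → Fin k) (f : X → X) (n : ℕ) (x y : X) :
    hFreq ℓ f n x y ≤ 1 := by
  unfold hFreq
  rw [inv_mul_eq_div]
  refine div_le_one_of_le₀ ?_ (by positivity)
  have := Finset.card_filter_le (Finset.Icc 1 n) (fun i => ℓ (f^[i] x) ≠ ℓ (f^[i] y))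
  rw [Nat.card_Icc] at this
  exact_mod_cast this

theorem VWB14.hFreq_measurable {X : Type*} [MeasurableSpace X] {k : ℕ} (ℓ : X → Fin k)
    (f : X → X) (n : ℕ) (hf : Measurable f) (hℓ : Measurable ℓ) :
    Measurable fun p : X × X => hFreq ℓ f n p.1 p.2 := by
  unfold hFreq
  simp_rw [Finset.card_filter, Nat.cast_sum]
  refine Measurable.const_mul (Finset.measurable_sum _ fun i _ => ?_) _
  have h1 : Measurable fun p : X × X => ℓ (f^[i] p.1) := hℓ.comp ((hf.iterate i).comp measurable_fst)
  have h2 : Measurable fun p : X × X => ℓ (f^[i] p.2) := hℓ.comp ((hf.iterate i).comp measurable_snd)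
  have h3 : Measurable fun q : Fin k × Fin k => (((if q.1 ≠ q.2 then 1 else 0 : ℕ)) : ℝ) :=
    Measurable.of_discrete
  exact h3.comp (h1.prodMk h2)

theorem VWB14.atom_aux {X : Type*} [MeasurableSpace X]
    (P μ : Measure X) [IsProbabilityMeasure P] [IsProbabilityMeasure μ]
    (f : X → X) (hf : Measurable f) {k : ℕ} (ℓ : X → Fin k) (hℓ : Measurable ℓ)
    (δ : ℝ) (hδ : 0 < δ) (hδ' : δ ≤ 1 / 2) (E : Set X) (θ : X → X) (hθ : IsEpsMP δ P μ E θ)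
    (D : Set X) (hD : MeasurableSet D) (hDP : 1 - δ < (P D).toReal)
    (n : ℕ) (hθD : ∀ x ∈ D, hFreq ℓ f n x (θ x) < δ) :
    ∃ lam : Measure (X × X), IsProbabilityMeasure lam ∧ lam.map Prod.fst = P ∧
      lam.map Prod.snd = μ ∧ ∫ p, hFreq ℓ f n p.1 p.2 ∂lam ≤ 5 * δ := by
  obtain ⟨G, -, hG, hGP, hGA⟩ := hθ
  let nm : X → ℕ := fun x => Encodable.encode (fun i : Fin n => ℓ (f^[(i : ℕ) + 1] x))
  have hnm : Measurable nm := by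
    have h1 : Measurable (fun x => (fun i : Fin n => ℓ (f^[(i : ℕ) + 1] x))) :=
      measurable_pi_lambda _ fun i => hℓ.comp (hf.iterate _)
    have h2 : Measurable (fun w : Fin n → Fin k => Encodable.encode w) := Measurable.of_discrete
    exact h2.comp h1
  have hname : ∀ x x' y, nm x = nm x' → hFreq ℓ f n x y = hFreq ℓ f n x' y := by
    intro x x' y h
    have h' := Encodable.encode_injective h
    unfold hFreq
    congr 3
    refine Finset.filter_congr fun i hi => ?_
    rw [Finset.mem_Icc] at hi
    have := congrFun h' ⟨i - 1, by omega⟩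
    simp only at this
    rw [Nat.sub_add_cancel hi.1] at this
    rw [this]
  let A : ℕ → Set X := fun i => (G ∩ D) ∩ nm ⁻¹' {i}
  have hA : ∀ i, MeasurableSet (A i) := fun i => (hG.inter hD).inter (hnm (measurableSet_singleton i))
  have hAG : ∀ i, A i ⊆ G := fun i x hx => hx.1.1
  let B : ℕ → Set X := disjointed fun i => θ '' (A i)
  have hB : ∀ i, MeasurableSet (B i) :=
    fun i => MeasurableSet.disjointed (fun i => (hGA _ (hAG i) (hA i)).1) i
  have hBs : ∀ i, B i ⊆ θ '' (A i) := fun i => disjointed_subset _ _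
  have hUA : ⋃ i, A i = G ∩ D := by
    ext x; simp [A]
  have hUB : ⋃ i, B i = θ '' (G ∩ D) := by
    rw [← hUA, Set.image_iUnion]; exact iUnion_disjointed
  let H : Set (X × X) := {p | δ ≤ hFreq ℓ f n p.1 p.2}
  have hmeas := hFreq_measurable ℓ f n hf hℓ
  have hH : MeasurableSet H := measurableSet_le measurable_const hmeas
  have hABm : ∀ i, μ (B i) ≤ ENNReal.ofReal (1 + δ) * P (A i) := by
    intro i
    refine (measure_mono (hBs i)).trans ?_
    have := (hGA _ (hAG i) (hA i)).2.2
    rw [← ENNReal.ofReal_toReal (measure_ne_top μ (θ '' A i)),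
      ← ENNReal.ofReal_toReal (measure_ne_top P (A i)), ← ENNReal.ofReal_mul (by linarith)]
    exact ENNReal.ofReal_le_ofReal this
  obtain ⟨lam, hp, h1, h2, h3⟩ := coupling_aux P μ A B hA hB
    (fun i j hij => by
      refine Set.disjoint_left.2 fun x hx hx' => hij ?_
      exact hx.2.symm.trans hx'.2)
    (disjoint_disjointed _) (ENNReal.ofReal (1 + δ)) (by
      rw [← ENNReal.ofReal_one]; exact ENNReal.ofReal_le_ofReal (by linarith))
    ENNReal.ofReal_ne_top hABm H hH (by
      intro i
      refine Set.disjoint_left.2 ?_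
      rintro ⟨x, y⟩ ⟨hx, hy⟩ hxy
      obtain ⟨x', hx', rfl⟩ := hBs i hy
      have e := hname x x' (θ x') (hx.2.trans hx'.2.symm)
      have := hθD x' hx'.1.2
      have hxy' : δ ≤ hFreq ℓ f n x (θ x') := hxy
      linarith)
  refine ⟨lam, hp, h1, h2, ?_⟩
  have hGD : 1 - 2 * δ < P.real (G ∩ D) := by
    have e := measureReal_union_add_inter (μ := P) (s := G) hD
    have : P.real (G ∪ D) ≤ 1 := measureReal_le_one
    change 1 - δ < P.real D at hDP
    change 1 - δ < P.real G at hGP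
    linarith
  have hθGD : (1 - δ) * P.real (G ∩ D) ≤ μ.real (⋃ i, B i) := by
    rw [hUB]
    exact (hGA _ Set.inter_subset_left (hG.inter hD)).2.1
  have hlamH : lam.real H ≤ 4 * δ := by
    have hle : lam.real H ≤ 1 - (1 + δ)⁻¹ * μ.real (⋃ i, B i) := by
      have hx := ENNReal.toReal_mono (ne_top_of_le_ne_top ENNReal.one_ne_top tsub_le_self) h3
      rw [ENNReal.toReal_sub_of_le _ ENNReal.one_ne_top, ENNReal.toReal_mul, ENNReal.toReal_inv,
        ENNReal.toReal_ofReal (by linarith), ENNReal.toReal_one] at hx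
      · exact hx
      · refine mul_le_one' ?_ prob_le_one
        rw [ENNReal.inv_le_one, ← ENNReal.ofReal_one]
        exact ENNReal.ofReal_le_ofReal (by linarith)
    have : 1 - 4 * δ ≤ (1 + δ)⁻¹ * μ.real (⋃ i, B i) := by
      rw [inv_mul_eq_div, le_div_iff₀ (by linarith)]
      nlinarith
    linarith
  have hint : Integrable (fun p : X × X => hFreq ℓ f n p.1 p.2) lam := by
    refine Integrable.of_bound hmeas.aestronglyMeasurable 1 (Filter.Eventually.of_forall fun p => ?_)
    rw [Real.norm_of_nonneg (hFreq_nonneg _ _ _ _ _)]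
    exact hFreq_le_one _ _ _ _ _
  have hint2 : Integrable (fun p : X × X => δ + H.indicator (fun _ => (1 : ℝ)) p) lam :=
    (integrable_const _).add ((integrable_const _).indicator hH)
  calc ∫ p, hFreq ℓ f n p.1 p.2 ∂lam ≤ ∫ p, δ + H.indicator (fun _ => (1 : ℝ)) p ∂lam := by
        refine integral_mono hint hint2 fun p => ?_
        by_cases hpH : p ∈ H
        · have := hFreq_le_one ℓ f n p.1 p.2
          simp only [Set.indicator_of_mem hpH]; linarith
        · have : hFreq ℓ f n p.1 p.2 < δ := not_le.1 hpH
          simp only [Set.indicator_of_notMem hpH]; linarith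
    _ = δ + lam.real H := by
        rw [integral_add (integrable_const _) ((integrable_const _).indicator hH),
          integral_indicator_const _ hH]
        simp
    _ ≤ 5 * δ := by linarith

/-- Let `(X, μ)` be a standard Borel probability space, `f` a measurable
bijection with measurable inverse `g` preserving `μ`, and `ξ` a finite measurable
partition with labeling map `ℓ`. Suppose for every `ε > 0` there is `N` such that for all
`m₂ ≥ m₁ ≥ N`, for `ε`-almost every atom `E` of `⋁_{j=m₁}^{m₂} f^j ξ` there are a map
`θ : E → X` which is `ε`-measure-preserving from `(E, μ|_E)` to `(X, μ)` and a measurable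
`D ⊆ E` with `μ|_E(D) > 1 − ε` and `h_n(x, θ(x)) < ε` for all `n ≥ 1`, `x ∈ D`. Then `ξ`
is Very Weak Bernoulli: for every `ε > 0` there is `N₀` such that for all `m₂ ≥ m₁ ≥ N₀`
and every `n ≥ 1`, for `ε`-almost every atom `E` of `⋁_{j=m₁}^{m₂} f^j ξ`, the infimum
over couplings `λ` of `(E, μ|_E)` and `(X, μ)` of `∫ h_n dλ` is at most `ε`. -/
theorem stmt14 {X : Type*} [MeasurableSpace X] [StandardBorelSpace X]
    (μ : Measure X) [IsProbabilityMeasure μ]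
    (f g : X → X) (hf : Measurable f) (hg : Measurable g)
    (hgf : Function.LeftInverse g f) (hfg : Function.RightInverse g f)
    (hinv : ∀ A : Set X, MeasurableSet A → μ (f ⁻¹' A) = μ A)
    {k : ℕ} (ℓ : X → Fin k) (hℓ : Measurable ℓ)
    (hyp : ∀ ε : ℝ, 0 < ε →
      ∃ N : ℕ, ∀ m₁ m₂ : ℕ, N ≤ m₁ → m₁ ≤ m₂ →
        AeAtoms μ ℓ g m₁ m₂ ε fun E =>
          ∃ θ : X → X, IsEpsMP ε (normRestrict μ E) μ E θ ∧
            ∃ D : Set X, D ⊆ E ∧ MeasurableSet D ∧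
              1 - ε < ((normRestrict μ E) D).toReal ∧
              ∀ n : ℕ, 1 ≤ n → ∀ x ∈ D, hFreq ℓ f n x (θ x) < ε) :
    ∀ ε : ℝ, 0 < ε →
      ∃ N₀ : ℕ, ∀ m₁ m₂ : ℕ, N₀ ≤ m₁ → m₁ ≤ m₂ → ∀ n : ℕ, 1 ≤ n →
        AeAtoms μ ℓ g m₁ m₂ ε fun E =>
          sInf {r : ℝ | ∃ lam : Measure (X × X),
            IsProbabilityMeasure lam ∧
            lam.map Prod.fst = normRestrict μ E ∧
            lam.map Prod.snd = μ ∧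
            r = ∫ p, hFreq ℓ f n p.1 p.2 ∂lam} ≤ ε := by
  intro ε hε
  set δ : ℝ := min (ε / 5) (1 / 2) with hδd
  have hδ : 0 < δ := lt_min (by linarith) (by norm_num)
  have hδ1 : δ ≤ ε / 5 := min_le_left _ _
  have hδ2 : δ ≤ 1 / 2 := min_le_right _ _
  obtain ⟨N, hN⟩ := hyp δ hδ
  refine ⟨N, fun m₁ m₂ h1 h2 n hn => ?_⟩
  have h := hN m₁ m₂ h1 h2
  unfold AeAtoms at h ⊢
  refine le_trans (ENNReal.toReal_mono (measure_ne_top _ _) (measure_mono ?_))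
    (h.trans (by linarith))
  refine Set.biUnion_subset_biUnion_left ?_
  rintro a ⟨hne, hnot⟩
  refine ⟨hne, fun hyes => hnot ?_⟩
  obtain ⟨θ, hθ, D, -, hD, hDP, hθD⟩ := hyes
  set E := joinAtom ℓ g m₁ m₂ a
  have hE : μ E ≠ 0 := by
    intro h0
    have : μ.restrict E = 0 := Measure.restrict_eq_zero.2 h0
    simp [normRestrict, this] at hDP
    linarith
  have : IsProbabilityMeasure (normRestrict μ E) := ⟨by
    rw [normRestrict, Measure.smul_apply, Measure.restrict_apply_univ, smul_eq_mul,
      ENNReal.inv_mul_cancel hE (measure_ne_top _ _)]⟩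
  obtain ⟨lam, hp, e1, e2, e3⟩ := atom_aux (normRestrict μ E) μ f hf ℓ hℓ δ hδ hδ2 E θ hθ D hD hDP n
    (fun x hx => hθD n hn x hx)
  refine le_trans (csInf_le ?_ ?_) (e3.trans (by linarith : 5 * δ ≤ ε))
  rotate_left
  · exact ⟨lam, hp, e1, e2, rfl⟩
  refine ⟨0, ?_⟩
  rintro r ⟨lam', -, -, -, rfl⟩
  exact integral_nonneg fun p => hFreq_nonneg _ _ _ _ _
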